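/- Fix β ∈ ℝ and real numbers 0 < λ₋ < λ < λ₊. Then for all sufficiently large m there exists an m×m symmetric positive definite real matrix A whose smallest eigenvalue equals λ₋, whose largest eigenvalue equals λ₊, and whose β-average eigenvalue satisfies Λ(A,β) = λ. -/

import Mathlib

open MeasureTheory Metric Filter
open scoped InnerProductSpace RealInnerProductSpace ENNReal NNReal

noncomputable section

/-- The uniform (normalized rotation-invariant) probability measure on the unit sphere
`S^{m-1}` of Euclidean `ℝ^m`, obtained by normalizing the canonical sphere measure induced
by the Lebesgue (Haar) measure. -/
def sphereUniform (m : ℕ) : Measure (sphere (0 : EuclideanSpace ℝ (Fin m)) 1) :=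
  (((volume : Measure (EuclideanSpace ℝ (Fin m))).toSphere) Set.univ)⁻¹ •
    ((volume : Measure (EuclideanSpace ℝ (Fin m))).toSphere)

/-- The quadratic form `θ ↦ ⟨θ, A θ⟩` associated to a matrix `A`. -/
def quadForm {m : ℕ} (A : Matrix (Fin m) (Fin m) ℝ) (θ : EuclideanSpace ℝ (Fin m)) : ℝ :=
  ⟪θ, Matrix.toEuclideanLin A θ⟫_ℝ

/-- `Z(A,s) := ∫_{S^{m-1}} ⟨θ,Aθ⟩^{-s} dσ(θ)`. -/
def Zfun {m : ℕ} (A : Matrix (Fin m) (Fin m) ℝ) (s : ℝ) : ℝ :=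
  ∫ θ : sphere (0 : EuclideanSpace ℝ (Fin m)) 1, quadForm A ↑θ ^ (-s) ∂(sphereUniform m)

/-- The `β`-average eigenvalue `Λ(A,β) := Z(A,β)/Z(A,1+β)`. -/
def lambdaAvg {m : ℕ} (A : Matrix (Fin m) (Fin m) ℝ) (β : ℝ) : ℝ :=
  Zfun A β / Zfun A (1 + β)

/-- The probability measure `μ_{A,β}` on `S^{m-1}` with density
`θ ↦ ⟨θ,Aθ⟩^{-1-β}/Z(A,1+β)` with respect to the uniform measure `σ`. -/
def muAB {m : ℕ} (A : Matrix (Fin m) (Fin m) ℝ) (β : ℝ) :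
    Measure (sphere (0 : EuclideanSpace ℝ (Fin m)) 1) :=
  (sphereUniform m).withDensity fun θ =>
    ENNReal.ofReal (quadForm A ↑θ ^ (-(1 + β)) / Zfun A (1 + β))

lemma rpow_upper {a b x : ℝ} (s : ℝ) (ha : 0 < a) (hx : x ∈ Set.Icc a b) :
    x ^ s ≤ a ^ s + b ^ s := by
  obtain ⟨h1, h2⟩ := hx
  have hx0 : 0 < x := ha.trans_le h1
  have hb0 : 0 < b := hx0.trans_le h2
  have e1 := (Real.rpow_pos_of_pos ha s).le
  have e2 := (Real.rpow_pos_of_pos hb0 s).le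
  rcases le_total 0 s with h | h
  · have := Real.rpow_le_rpow hx0.le h2 h
    linarith
  · have := Real.rpow_le_rpow_of_nonpos ha h1 h
    linarith

lemma rpow_lower {a b x : ℝ} (s : ℝ) (ha : 0 < a) (hx : x ∈ Set.Icc a b) :
    min (a ^ s) (b ^ s) ≤ x ^ s := by
  obtain ⟨h1, h2⟩ := hx
  have hx0 : 0 < x := ha.trans_le h1
  rcases le_total 0 s with h | h
  · exact (min_le_left _ _).trans (Real.rpow_le_rpow ha.le h1 h)
  · exact (min_le_right _ _).trans (Real.rpow_le_rpow_of_nonpos hx0 h2 h)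

lemma rpow_integrable {X : Type*} [TopologicalSpace X] [MeasurableSpace X] [BorelSpace X]
    {μ : Measure X} [IsFiniteMeasure μ] {q : X → ℝ} (hq : Continuous q) {a b : ℝ} (ha : 0 < a)
    (hqab : ∀ x, q x ∈ Set.Icc a b) (s : ℝ) : Integrable (fun x => q x ^ s) μ := by
  have hc : Continuous (fun x => q x ^ s) :=
    hq.rpow_const (fun x => Or.inl (ha.trans_le (hqab x).1).ne')
  refine Integrable.of_bound hc.measurable.aestronglyMeasurable (a ^ s + b ^ s) ?_
  filter_upwards with x
  rw [Real.norm_of_nonneg (Real.rpow_nonneg (ha.le.trans (hqab x).1) s)]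
  exact rpow_upper s ha (hqab x)

lemma ratio_pos {X : Type*} [TopologicalSpace X] [MeasurableSpace X] [BorelSpace X]
    {μ : Measure X} [IsProbabilityMeasure μ] {q : X → ℝ} (hq : Continuous q) {a b : ℝ}
    (ha : 0 < a) (hqab : ∀ x, q x ∈ Set.Icc a b) (s : ℝ) :
    min (a ^ s) (b ^ s) ≤ ∫ x, q x ^ s ∂μ := by
  have := integral_mono (μ := μ) (integrable_const (min (a ^ s) (b ^ s)))
    (rpow_integrable hq ha hqab s) (fun x => rpow_lower s ha (hqab x))
  simpa using this

lemma ratio_bound {X : Type*} [TopologicalSpace X] [MeasurableSpace X] [BorelSpace X]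
    {μ : Measure X} [IsProbabilityMeasure μ] {q y : X → ℝ} (hq : Continuous q) {a b : ℝ}
    (ha : 0 < a) (hab : a ≤ b) (hqab : ∀ x, q x ∈ Set.Icc a b) (β l ε : ℝ)
    (hy0 : ∀ x, |q x - l| ≤ y x) (hy : Integrable y μ) (hε : ∫ x, y x ∂μ ≤ ε) :
    |(∫ x, q x ^ (-β) ∂μ) / (∫ x, q x ^ (-(1 + β)) ∂μ) - l| ≤
      (a ^ (-(1 + β)) + b ^ (-(1 + β))) * ε / min (a ^ (-(1 + β))) (b ^ (-(1 + β))) := by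
  have hb : 0 < b := ha.trans_le hab
  set s := -(1 + β) with hs
  have hc : 0 < min (a ^ s) (b ^ s) :=
    lt_min (Real.rpow_pos_of_pos ha s) (Real.rpow_pos_of_pos hb s)
  have hC : 0 < a ^ s + b ^ s :=
    add_pos (Real.rpow_pos_of_pos ha s) (Real.rpow_pos_of_pos hb s)
  have hI := ratio_pos (μ := μ) hq ha hqab s
  set I := ∫ x, q x ^ s ∂μ with hIdef
  have hIpos : 0 < I := hc.trans_le hI
  have e : (∫ x, q x ^ (-β) ∂μ) - l * I = ∫ x, (q x ^ (-β) - l * q x ^ s) ∂μ := by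
    rw [integral_sub (rpow_integrable hq ha hqab _) ((rpow_integrable hq ha hqab _).const_mul l),
      integral_const_mul]
  have key : |(∫ x, q x ^ (-β) ∂μ) - l * I| ≤ (a ^ s + b ^ s) * ε := by
    rw [e]
    have h1 := norm_integral_le_of_norm_le (μ := μ) (f := fun x => q x ^ (-β) - l * q x ^ s)
      (g := fun x => (a ^ s + b ^ s) * y x) (hy.const_mul _) (by
        filter_upwards with x
        have hx0 : 0 < q x := ha.trans_le (hqab x).1
        have : q x ^ (-β) = q x * q x ^ s := by
          have h3 := Real.rpow_add hx0 1 s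
          rw [Real.rpow_one] at h3
          rw [← h3, hs]
          congr 1
          ring
        rw [this, ← sub_mul, Real.norm_eq_abs, abs_mul,
          abs_of_pos (Real.rpow_pos_of_pos hx0 s), mul_comm]
        exact mul_le_mul (rpow_upper s ha (hqab x)) (hy0 x) (abs_nonneg _) hC.le)
    rw [integral_const_mul] at h1
    exact h1.trans (mul_le_mul_of_nonneg_left hε hC.le)
  have e2 : (∫ x, q x ^ (-β) ∂μ) / I - l = ((∫ x, q x ^ (-β) ∂μ) - l * I) / I := by
    field_simp
  rw [e2, abs_div, abs_of_pos hIpos]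
  exact div_le_div₀ ((abs_nonneg _).trans key) key hc hI

instance sphereUniform_prob (m : ℕ) [NeZero m] : IsProbabilityMeasure (sphereUniform m) := by
  haveI : Nonempty (Fin m) := ⟨0⟩
  constructor
  rw [sphereUniform, Measure.smul_apply, smul_eq_mul]
  refine ENNReal.inv_mul_cancel ?_ (measure_ne_top _ _)
  rw [Measure.toSphere_apply_univ]
  refine mul_ne_zero ?_ ?_
  · simp [NeZero.ne m]
  · exact (measure_ball_pos _ _ one_pos).ne'

lemma quadForm_diag {m : ℕ} (d : Fin m → ℝ) (θ : EuclideanSpace ℝ (Fin m)) :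
    quadForm (Matrix.diagonal d) θ = ∑ k, d k * θ k ^ 2 := by
  rw [quadForm, PiLp.inner_apply]
  refine Finset.sum_congr rfl fun k _ => ?_
  simp [Matrix.toEuclideanLin, Matrix.toLpLin_apply, Matrix.mulVec_diagonal]
  ring

lemma sphere_sum {m : ℕ} (θ : sphere (0 : EuclideanSpace ℝ (Fin m)) 1) :
    ∑ k, (θ : EuclideanSpace ℝ (Fin m)) k ^ 2 = 1 := by
  have h : ‖(θ : EuclideanSpace ℝ (Fin m))‖ = 1 := by simpa using θ.2
  have := EuclideanSpace.norm_sq_eq (θ : EuclideanSpace ℝ (Fin m))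
  rw [h] at this
  simpa using this.symm

lemma coord_cont {m : ℕ} (k : Fin m) : Continuous
    (fun θ : sphere (0 : EuclideanSpace ℝ (Fin m)) 1 => (θ : EuclideanSpace ℝ (Fin m)) k ^ 2) := by
  fun_prop

lemma coord_int {m : ℕ} [NeZero m] (k : Fin m) : Integrable
    (fun θ : sphere (0 : EuclideanSpace ℝ (Fin m)) 1 => (θ : EuclideanSpace ℝ (Fin m)) k ^ 2)
    (sphereUniform m) := by
  refine Integrable.of_bound (coord_cont k).measurable.aestronglyMeasurable 1 ?_
  filter_upwards with θ
  rw [Real.norm_of_nonneg (sq_nonneg _)]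
  refine le_of_le_of_eq ?_ (sphere_sum θ)
  exact Finset.single_le_sum (f := fun k => (θ : EuclideanSpace ℝ (Fin m)) k ^ 2)
    (fun i _ => sq_nonneg _) (Finset.mem_univ k)

lemma exists_coords {m : ℕ} [NeZero m] (hm : 2 ≤ m) : ∃ i j : Fin m, i ≠ j ∧
    (∫ θ, (θ : EuclideanSpace ℝ (Fin m)) i ^ 2 ∂(sphereUniform m)) ≤ 1 / ((m : ℝ) - 1) ∧
    (∫ θ, (θ : EuclideanSpace ℝ (Fin m)) j ^ 2 ∂(sphereUniform m)) ≤ 1 / ((m : ℝ) - 1) := by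
  set a : Fin m → ℝ := fun k =>
    ∫ θ, (θ : EuclideanSpace ℝ (Fin m)) k ^ 2 ∂(sphereUniform m) with ha
  have ha0 : ∀ k, 0 ≤ a k := fun k => integral_nonneg fun θ => sq_nonneg _
  have hsum : ∑ k, a k = 1 := by
    rw [ha, ← integral_finset_sum _ (fun k _ => coord_int k)]
    simp [sphere_sum]
  have hm1 : (0 : ℝ) < (m : ℝ) - 1 := by
    have : (2 : ℝ) ≤ m := by exact_mod_cast hm
    linarith
  have aux : ∀ i : Fin m, ∃ j, i ≠ j ∧ a j ≤ 1 / ((m : ℝ) - 1) := by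
    intro i
    have hcard : ((Finset.univ.erase i).card : ℝ) = (m : ℝ) - 1 := by
      rw [Finset.card_erase_of_mem (Finset.mem_univ i), Finset.card_univ, Fintype.card_fin,
        Nat.cast_sub (by omega), Nat.cast_one]
    have hne : (Finset.univ.erase i).Nonempty := by
      rw [← Finset.card_pos]
      exact_mod_cast hcard ▸ hm1
    obtain ⟨j, hj, hle⟩ := Finset.exists_le_of_sum_le hne (f := a)
      (g := fun _ => 1 / ((m : ℝ) - 1)) (by
        rw [Finset.sum_const, nsmul_eq_mul, hcard, mul_one_div_cancel hm1.ne', ← hsum]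
        exact Finset.sum_le_sum_of_subset_of_nonneg (Finset.erase_subset _ _)
          (fun k _ _ => ha0 k))
    exact ⟨j, (Finset.ne_of_mem_erase hj).symm, hle⟩
  obtain ⟨i, -, hi⟩ := aux 0
  obtain ⟨j, hij, hj⟩ := aux i
  exact ⟨i, j, hij, hi, hj⟩

lemma eig_range {m : ℕ} (d : Fin m → ℝ) (h : (Matrix.diagonal d).IsHermitian) :
    Set.range h.eigenvalues = Set.range d := by
  rw [← h.spectrum_real_eq_range_eigenvalues, spectrum_diagonal]

/-- The diagonal with entries `a`, `b` at the places `i`, `j` and `t` elsewhere. -/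
def dvec {m : ℕ} (i j : Fin m) (a b t : ℝ) : Fin m → ℝ :=
  fun k => if k = i then a else if k = j then b else t

lemma dvec_mem {m : ℕ} (i j : Fin m) {a b t : ℝ} (hab : a ≤ b) (ht : t ∈ Set.Icc a b)
    (k : Fin m) : dvec i j a b t k ∈ Set.Icc a b := by
  unfold dvec
  split_ifs
  exacts [⟨le_rfl, hab⟩, ⟨hab, le_rfl⟩, ht]

lemma dvec_quad {m : ℕ} (i j : Fin m) (hij : i ≠ j) (a b t : ℝ)
    (θ : sphere (0 : EuclideanSpace ℝ (Fin m)) 1) :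
    quadForm (Matrix.diagonal (dvec i j a b t)) (θ : EuclideanSpace ℝ (Fin m)) =
      t + (a - t) * (θ : EuclideanSpace ℝ (Fin m)) i ^ 2
        + (b - t) * (θ : EuclideanSpace ℝ (Fin m)) j ^ 2 := by
  rw [quadForm_diag]
  have : ∀ k, dvec i j a b t k * (θ : EuclideanSpace ℝ (Fin m)) k ^ 2 =
      t * (θ : EuclideanSpace ℝ (Fin m)) k ^ 2 +
      (if k = i then (a - t) * (θ : EuclideanSpace ℝ (Fin m)) k ^ 2 else 0) +
      (if k = j then (b - t) * (θ : EuclideanSpace ℝ (Fin m)) k ^ 2 else 0) := by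
    intro k
    unfold dvec
    by_cases h1 : k = i
    · subst h1
      simp [hij]
      ring
    · by_cases h2 : k = j
      · simp [h1, h2, hij.symm]
        ring
      · simp [h1, h2]
  simp only [this]
  rw [Finset.sum_add_distrib, Finset.sum_add_distrib, ← Finset.mul_sum, sphere_sum]
  simp

lemma quad_mem {m : ℕ} {d : Fin m → ℝ} {a b : ℝ} (hd : ∀ k, d k ∈ Set.Icc a b)
    (θ : sphere (0 : EuclideanSpace ℝ (Fin m)) 1) :
    quadForm (Matrix.diagonal d) (θ : EuclideanSpace ℝ (Fin m)) ∈ Set.Icc a b := by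
  rw [quadForm_diag]
  have h := sphere_sum θ
  constructor
  · calc a = ∑ k, a * (θ : EuclideanSpace ℝ (Fin m)) k ^ 2 := by
          rw [← Finset.mul_sum, h, mul_one]
      _ ≤ _ := Finset.sum_le_sum fun k _ =>
          mul_le_mul_of_nonneg_right (hd k).1 (sq_nonneg _)
  · calc _ ≤ ∑ k, b * (θ : EuclideanSpace ℝ (Fin m)) k ^ 2 := Finset.sum_le_sum fun k _ =>
          mul_le_mul_of_nonneg_right (hd k).2 (sq_nonneg _)
      _ = b := by rw [← Finset.mul_sum, h, mul_one]

lemma quad_cont {m : ℕ} (d : Fin m → ℝ) : Continuous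
    (fun θ : sphere (0 : EuclideanSpace ℝ (Fin m)) 1 =>
      quadForm (Matrix.diagonal d) (θ : EuclideanSpace ℝ (Fin m))) := by
  simp only [quadForm_diag]
  fun_prop

lemma Z_cont {m : ℕ} [NeZero m] (i j : Fin m) (hij : i ≠ j) {a b : ℝ} (ha : 0 < a) (hab : a ≤ b)
    (s : ℝ) :
    ContinuousOn (fun t => Zfun (Matrix.diagonal (dvec i j a b t)) s) (Set.Icc a b) := by
  unfold Zfun
  refine continuousOn_of_dominated (bound := fun _ => a ^ (-s) + b ^ (-s)) ?_ ?_
    (integrable_const _) ?_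
  · intro t ht
    exact (rpow_integrable (quad_cont _) ha (quad_mem (dvec_mem i j hab ht)) _).1
  · intro t ht
    filter_upwards with θ
    have := quad_mem (dvec_mem i j hab ht) θ
    rw [Real.norm_of_nonneg (Real.rpow_nonneg (ha.le.trans this.1) _)]
    exact rpow_upper _ ha this
  · filter_upwards with θ
    refine ContinuousOn.rpow_const ?_ ?_
    · simp only [dvec_quad i j hij]
      fun_prop
    · intro t ht
      exact Or.inl (ha.trans_le (quad_mem (dvec_mem i j hab ht) θ).1).ne'

/-- fix `β ∈ ℝ` and `0 < λ₋ < λ < λ₊`; then for all sufficiently large `m` there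
exists an `m×m` symmetric positive definite real matrix `A` with smallest eigenvalue `λ₋`,
largest eigenvalue `λ₊` and `Λ(A,β) = λ`. -/
theorem statement17 (β lamm lam lamp : ℝ) (h0 : 0 < lamm) (h1 : lamm < lam)
    (h2 : lam < lamp) :
    ∃ M : ℕ, ∀ m : ℕ, M ≤ m →
      ∃ A : Matrix (Fin m) (Fin m) ℝ, ∃ hA : A.PosDef,
        (⨅ i, hA.isHermitian.eigenvalues i) = lamm ∧
        (⨆ i, hA.isHermitian.eigenvalues i) = lamp ∧
        lambdaAvg A β = lam := by
  have hab : lamm ≤ lamp := (h1.trans h2).le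
  have hb0 : 0 < lamp := h0.trans_le hab
  set s := -(1 + β) with hs
  set c := min (lamm ^ s) (lamp ^ s) with hcdef
  set C := lamm ^ s + lamp ^ s with hCdef
  have hc : 0 < c := lt_min (Real.rpow_pos_of_pos h0 s) (Real.rpow_pos_of_pos hb0 s)
  have hC : 0 < C := add_pos (Real.rpow_pos_of_pos h0 s) (Real.rpow_pos_of_pos hb0 s)
  set δ := min (lam - lamm) (lamp - lam) with hδdef
  have hδ : 0 < δ := lt_min (by linarith) (by linarith)
  obtain ⟨N, hN⟩ := exists_nat_gt (C * (lamp - lamm) / c / δ)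
  refine ⟨N + 2, fun m hm => ?_⟩
  have hm2 : 2 ≤ m := by omega
  haveI : NeZero m := ⟨by omega⟩
  have hmN : (N : ℝ) + 1 ≤ (m : ℝ) - 1 := by
    have : ((N + 2 : ℕ) : ℝ) ≤ m := by exact_mod_cast hm
    push_cast at this
    linarith
  have hm1 : (0 : ℝ) < (m : ℝ) - 1 := lt_of_lt_of_le (by positivity) hmN
  have hsmall : C * ((lamp - lamm) * (1 / ((m : ℝ) - 1))) / c ≤ δ := by
    have h3 : C * (lamp - lamm) / c / δ ≤ (m : ℝ) - 1 := by linarith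
    rw [div_le_iff₀ hδ] at h3
    have : C * ((lamp - lamm) * (1 / ((m : ℝ) - 1))) / c
        = C * (lamp - lamm) / c / ((m : ℝ) - 1) := by field_simp
    rw [this, div_le_iff₀ hm1]
    linarith
  obtain ⟨i, j, hij, hi, hj⟩ := exists_coords hm2
  set f : ℝ → ℝ := fun t => lambdaAvg (Matrix.diagonal (dvec i j lamm lamp t)) β with hf
  have hfc : ContinuousOn f (Set.Icc lamm lamp) := by
    refine (Z_cont i j hij h0 hab β).div (Z_cont i j hij h0 hab (1 + β)) ?_
    intro t ht
    exact (hc.trans_le (ratio_pos (quad_cont _) h0 (quad_mem (dvec_mem i j hab ht)) s)).ne'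
  have hK : 0 ≤ lamp - lamm := by linarith
  have hlo : |f lamm - lamm| ≤ C * ((lamp - lamm) * (1 / ((m : ℝ) - 1))) / c := by
    refine ratio_bound (quad_cont _) h0 hab
      (quad_mem (dvec_mem i j hab ⟨le_rfl, hab⟩)) β lamm _
      (y := fun θ : sphere (0 : EuclideanSpace ℝ (Fin m)) 1 => (lamp - lamm) * (θ : EuclideanSpace ℝ (Fin m)) j ^ 2) ?_
      ((coord_int j).const_mul _) ?_
    · intro θ
      rw [dvec_quad i j hij, sub_self, zero_mul, add_zero, add_sub_cancel_left, abs_of_nonneg]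
      positivity
    · rw [integral_const_mul]
      exact mul_le_mul_of_nonneg_left hj hK
  have hhi : |f lamp - lamp| ≤ C * ((lamp - lamm) * (1 / ((m : ℝ) - 1))) / c := by
    refine ratio_bound (quad_cont _) h0 hab
      (quad_mem (dvec_mem i j hab ⟨hab, le_rfl⟩)) β lamp _
      (y := fun θ : sphere (0 : EuclideanSpace ℝ (Fin m)) 1 => (lamp - lamm) * (θ : EuclideanSpace ℝ (Fin m)) i ^ 2) ?_
      ((coord_int i).const_mul _) ?_
    · intro θ
      rw [dvec_quad i j hij, sub_self, zero_mul, add_zero, add_sub_cancel_left, abs_mul,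
        abs_sub_comm, abs_of_nonneg hK, abs_of_nonneg (sq_nonneg _)]
    · rw [integral_const_mul]
      exact mul_le_mul_of_nonneg_left hi hK
  have hlo2 : f lamm ≤ lam := by
    have := (abs_le.1 (hlo.trans hsmall)).2
    have := min_le_left (lam - lamm) (lamp - lam)
    linarith
  have hhi2 : lam ≤ f lamp := by
    have := (abs_le.1 (hhi.trans hsmall)).1
    have := min_le_right (lam - lamm) (lamp - lam)
    linarith
  obtain ⟨t, ht, hft⟩ := intermediate_value_Icc hab hfc ⟨hlo2, hhi2⟩
  have hmem := dvec_mem i j hab ht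
  refine ⟨Matrix.diagonal (dvec i j lamm lamp t),
    Matrix.PosDef.diagonal (fun k => h0.trans_le (hmem k).1), ?_, ?_, hft⟩
  · rw [iInf, eig_range]
    refine IsLeast.csInf_eq ⟨⟨i, by simp [dvec]⟩, ?_⟩
    rintro _ ⟨k, rfl⟩
    exact (hmem k).1
  · rw [iSup, eig_range]
    refine IsGreatest.csSup_eq ⟨⟨j, by simp [dvec, hij.symm]⟩, ?_⟩
    rintro _ ⟨k, rfl⟩
    exact (hmem k).2
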